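/- Let 1 ≤ r ≤ n and let f be a polynomial in r variables with coefficients in ℚ. Then in ℚ(x_1,…,x_n) one has Σ_{w∈C(r,n)} w·( f(x_1,…,x_r) / ∏_{i=1}^{r} ∏_{j=i+1}^{n} (x_i − x_j) ) = [t_1^{n−1} t_2^{n−1} ⋯ t_r^{n−1}]( f(t_1,…,t_r) · ∏_{1≤i<j≤r} (t_j − t_i) · ∏_{i=1}^{r} ∏_{j=1}^{n} ( Σ_{k≥0} x_j^k t_i^{−k} ) ), where on the right the product is formed in the ring of polynomials in t_1,…,t_r over formal power series in t_1^{−1},…,t_r^{−1} with coefficients in ℚ[x_1,…,x_n], and [t_1^{n−1}⋯t_r^{n−1}] extracts the coefficient of t_1^{n−1}⋯t_r^{n−1} (each coefficient involves only finitely many terms). This is the additive (ordinary cohomology) specialization of the type-A Darondeau–Pragacz push-forward formula for the partial flag bundle. -/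

import Mathlib

open Finset

noncomputable section

instance finWF (r : ℕ) : WellFoundedLT (Fin r) :=
  inferInstanceAs (IsWellFounded (Fin r) (· < ·))

/-- The field `ℚ(x_1, …, x_n)` of rational functions. -/
abbrev K (n : ℕ) : Type := FractionRing (MvPolynomial (Fin n) ℚ)

/-- The indeterminate `x_i` (`0`-indexed). -/
def x (n : ℕ) (i : Fin n) : K n :=
  algebraMap (MvPolynomial (Fin n) ℚ) (K n) (MvPolynomial.X i)

/-- The coset representatives `C(r,n)`: permutations `w` of `{0, …, n-1}` that are
strictly increasing on positions `r, r+1, …, n-1` (`0`-indexed). -/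
def Cperm (r n : ℕ) : Finset (Equiv.Perm (Fin n)) :=
  Finset.univ.filter fun w => ∀ i j : Fin n, r ≤ (i : ℕ) → i < j → w i < w j

/-- The ring of polynomials in `t_1, …, t_r` over formal power series in
`t_1⁻¹, …, t_r⁻¹` with coefficients in `ℚ[x]`, realized inside the Hahn series field over
the lexicographically ordered group `ℤ^r`. -/
abbrev H (n r : ℕ) := HahnSeries (Lex (Fin r → ℤ)) (K n)

/-- The variable `t_i` (`0`-indexed). -/
def t (n r : ℕ) (i : Fin r) : H n r :=
  HahnSeries.single (toLex (Pi.single (Fin.rev i) (-1 : ℤ))) 1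

/-- The product `∏ i, φ i (t_i⁻¹)` of one-variable Laurent series `φ i` in `t_i⁻¹`. -/
def laurentProd (n r : ℕ) (φ : Fin r → HahnSeries ℤ (K n)) : H n r where
  coeff b := ∏ i, (φ i).coeff (ofLex b (Fin.rev i))
  isPWO_support' := by
    have h : (Set.pi Set.univ fun i : Fin r => (φ (Fin.rev i)).support).IsPWO :=
      Set.IsPWO.pi fun i => (φ (Fin.rev i)).isPWO_support
    refine (h.image_of_monotone Pi.toLex_monotone).mono fun b hb => ⟨ofLex b, fun i _ => ?_, rfl⟩
    have := (Finset.prod_ne_zero_iff.1 hb) (Fin.rev i) (Finset.mem_univ _)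
    simpa using this

theorem laurentProd_coeff (n r : ℕ) (φ : Fin r → HahnSeries ℤ (K n)) (b : Lex (Fin r → ℤ)) :
    (laurentProd n r φ).coeff b = ∏ i, (φ i).coeff (ofLex b (Fin.rev i)) := rfl

theorem laurentProd_one (n r : ℕ) : laurentProd n r (fun _ => 1) = 1 := by
  ext b
  rw [laurentProd_coeff, HahnSeries.coeff_one]
  simp only [HahnSeries.coeff_one]
  split_ifs with h
  · subst h
    exact Finset.prod_eq_one fun i _ => if_pos rfl
  · obtain ⟨i, hi⟩ : ∃ i, ofLex b i ≠ 0 := by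
      by_contra! hb
      exact h (funext hb)
    refine Finset.prod_eq_zero (Finset.mem_univ (Fin.rev i)) (if_neg ?_)
    simpa using hi

theorem inv_t (n r : ℕ) (i : Fin r) :
    (t n r i)⁻¹ = HahnSeries.single (toLex (Pi.single (Fin.rev i) (1 : ℤ))) 1 := by
  rw [t, HahnSeries.inv_single, ← toLex_neg, ← Pi.single_neg, neg_neg, inv_one]

theorem one_sub_mul_laurentProd (n r : ℕ) (φ : Fin r → HahnSeries ℤ (K n)) (i : Fin r) (c : K n) :
    (1 - HahnSeries.C c * (t n r i)⁻¹) * laurentProd n r φ =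
      laurentProd n r (Function.update φ i ((1 - HahnSeries.single 1 c) * φ i)) := by
  ext b
  rw [inv_t, HahnSeries.C_apply, HahnSeries.single_mul_single, sub_mul, one_mul,
    HahnSeries.coeff_sub, HahnSeries.coeff_single_mul]
  simp only [laurentProd_coeff]
  rw [← Finset.mul_prod_erase _ _ (Finset.mem_univ i),
    ← Finset.mul_prod_erase _ _ (Finset.mem_univ i),
    ← Finset.mul_prod_erase (Finset.univ : Finset (Fin r))
      (fun k => (Function.update φ i _ k).coeff _) (Finset.mem_univ i)]
  have h1 : ∀ k ∈ Finset.univ.erase i,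
      (φ k).coeff (ofLex (b - (0 + toLex (Pi.single (Fin.rev i) (1 : ℤ)) : Lex (Fin r → ℤ))) (Fin.rev k)) =
        (φ k).coeff (ofLex b (Fin.rev k)) := by
    intro k hk
    have : Fin.rev k ≠ Fin.rev i := fun h => Finset.ne_of_mem_erase hk (Fin.rev_injective h)
    rw [zero_add, ofLex_sub, Pi.sub_apply, ofLex_toLex, Pi.single_eq_of_ne this, sub_zero]
  have h2 : ∀ k ∈ Finset.univ.erase i,
      (Function.update φ i ((1 - HahnSeries.single 1 c) * φ i) k).coeff (ofLex b (Fin.rev k)) =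
        (φ k).coeff (ofLex b (Fin.rev k)) := by
    intro k hk
    rw [Function.update_of_ne (Finset.ne_of_mem_erase hk)]
  have h3 : ofLex (b - (0 + toLex (Pi.single (Fin.rev i) (1 : ℤ)) : Lex (Fin r → ℤ)))
      (Fin.rev i) = ofLex b (Fin.rev i) - 1 := by
    rw [zero_add, ofLex_sub, Pi.sub_apply, ofLex_toLex, Pi.single_eq_same]
  rw [Finset.prod_congr rfl h1, Finset.prod_congr rfl h2, h3, Function.update_self, sub_mul,
    one_mul, HahnSeries.coeff_sub, HahnSeries.coeff_single_mul]
  ring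

theorem prod_one_sub_mul_laurentProd {n : ℕ} (r : ℕ) (s : Finset (Fin r × Fin n))
    (φ : Fin r → HahnSeries ℤ (K n)) :
    (∏ p ∈ s, (1 - HahnSeries.C (x n p.2) * (t n r p.1)⁻¹)) * laurentProd n r φ =
      laurentProd n r fun i =>
        (∏ p ∈ s with p.1 = i, (1 - HahnSeries.single 1 (x n p.2))) * φ i := by
  induction s using Finset.induction_on with
  | empty => simp
  | insert p s hp ih =>
    rw [Finset.prod_insert hp, mul_assoc, ih, one_sub_mul_laurentProd]
    congr 1
    ext1 i
    rw [Finset.filter_insert]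
    rcases eq_or_ne i p.1 with rfl | h
    · rw [Function.update_self, if_pos rfl, Finset.prod_insert (by simp [hp]), mul_assoc]
    · rw [Function.update_of_ne h, if_neg h.symm]

theorem one_sub_single_ne_zero {F : Type*} [Field F] (c : F) :
    (1 - HahnSeries.single 1 c : HahnSeries ℤ F) ≠ 0 := by
  intro h
  have := congrArg (fun s => s.coeff 0) h
  simp at this

theorem prod_inv_eq_laurentProd (n r : ℕ) :
    ∏ i : Fin r, ∏ j : Fin n, (1 - HahnSeries.C (x n j) * (t n r i)⁻¹)⁻¹ =
      laurentProd n r fun _ => ∏ j, (1 - HahnSeries.single 1 (x n j))⁻¹ := by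
  rw [← Fintype.prod_prod_type', Finset.prod_inv_distrib]
  symm
  apply eq_inv_of_mul_eq_one_right
  rw [prod_one_sub_mul_laurentProd, ← laurentProd_one]
  congr 1
  ext1 i
  rw [Finset.prod_filter, Fintype.prod_prod_type]
  simp only [Finset.prod_ite_irrel, Finset.prod_const_one, Finset.prod_ite_eq', Finset.mem_univ,
    if_true]
  rw [← Finset.prod_mul_distrib]
  exact Finset.prod_eq_one fun j _ => mul_inv_cancel₀ (one_sub_single_ne_zero _)

theorem coeff_inv_one_sub_single {F : Type*} [Field F] (c : F) (m : ℕ) :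
    ((1 - HahnSeries.single 1 c : HahnSeries ℤ F)⁻¹).coeff m = c ^ m := by
  have h : (1 - PowerSeries.C c * PowerSeries.X) * PowerSeries.mk (fun k => c ^ k) = 1 := by
    ext k
    rw [sub_mul, one_mul, mul_assoc, map_sub, PowerSeries.coeff_C_mul]
    cases k with
    | zero => simp
    | succ k =>
      rw [PowerSeries.coeff_succ_X_mul]
      simp [PowerSeries.coeff_one, pow_succ']
  have h' := congrArg (HahnSeries.ofPowerSeries ℤ F) h
  rw [map_mul, map_sub, map_mul, map_one, HahnSeries.ofPowerSeries_C, HahnSeries.ofPowerSeries_X,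
    HahnSeries.C_apply, HahnSeries.single_mul_single, zero_add, mul_one] at h'
  rw [← eq_inv_of_mul_eq_one_right h']
  simp

theorem sum_div_sub_eq {L ι : Type*} [Field L] [Fintype ι] [DecidableEq ι] [Nonempty ι]
    {v : ι → L} (hv : Function.Injective v) {T : L} (hT : ∀ k, T - v k ≠ 0) :
    ∑ k, (∏ j ∈ Finset.univ.erase k, (v k - v j))⁻¹ * (T - v k)⁻¹ = ∏ j, (T - v j)⁻¹ := by
  have h := congrArg (Polynomial.eval T)
    (Lagrange.sum_basis (s := Finset.univ) hv.injOn Finset.univ_nonempty)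
  rw [Polynomial.eval_finsetSum, Polynomial.eval_one] at h
  rw [Finset.prod_inv_distrib, ← one_mul (∏ j, (T - v j))⁻¹, ← h, Finset.sum_mul]
  refine Finset.sum_congr rfl fun k _ => ?_
  rw [Lagrange.basis, Polynomial.eval_prod, ← Finset.mul_prod_erase _ _ (Finset.mem_univ k)]
  have : ∏ j ∈ Finset.univ.erase k, (T - v j) ≠ 0 := Finset.prod_ne_zero_iff.2 fun j _ => hT j
  simp only [Lagrange.basisDivisor, Polynomial.eval_mul, Polynomial.eval_C, Polynomial.eval_sub,
    Polynomial.eval_X, Finset.prod_mul_distrib, Finset.prod_inv_distrib]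
  field_simp [hT k]

theorem coeff_prod_inv_one_sub_single {F : Type*} [Field F] {n : ℕ} (hn : 1 ≤ n) {v : Fin n → F}
    (hv : Function.Injective v) (m : ℕ) :
    (∏ j, (1 - HahnSeries.single 1 (v j) : HahnSeries ℤ F)⁻¹).coeff (1 - n + m) =
      ∑ k, v k ^ m / ∏ j ∈ Finset.univ.erase k, (v k - v j) := by
  have : Nonempty (Fin n) := ⟨⟨0, hn⟩⟩
  let T : HahnSeries ℤ F := HahnSeries.single (-1) 1
  have hT : ∀ k, T - HahnSeries.C (v k) = T * (1 - HahnSeries.single 1 (v k)) := fun k => by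
    simp [T, mul_sub, HahnSeries.single_mul_single, HahnSeries.C_apply]
  have hT0 : T ≠ 0 := HahnSeries.single_ne_zero one_ne_zero
  have hTinv : T⁻¹ = HahnSeries.single 1 1 := by simp [T, HahnSeries.inv_single]
  have h := sum_div_sub_eq (v := fun k => (HahnSeries.C (v k) : HahnSeries ℤ F)) (T := T)
    (HahnSeries.C_injective.comp hv)
    (fun k => by rw [hT]; exact mul_ne_zero hT0 (one_sub_single_ne_zero _))
  simp only [hT, mul_inv, ← map_sub, ← map_prod, ← map_inv₀, Finset.prod_mul_distrib, hTinv,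
    Finset.prod_const, Finset.card_univ, Fintype.card_fin, HahnSeries.single_pow] at h
  have h' := congrArg (fun s => s.coeff (1 + (m : ℤ))) h
  simp only [HahnSeries.coeff_single_mul, one_pow, one_mul, nsmul_eq_mul, mul_one] at h'
  rw [show (1 - n + m : ℤ) = 1 + m - n by ring, ← h', HahnSeries.coeff_sum]
  refine Finset.sum_congr rfl fun k _ => ?_
  rw [HahnSeries.C_apply, HahnSeries.coeff_single_mul, HahnSeries.coeff_single_mul, sub_zero,
    add_sub_cancel_left, coeff_inv_one_sub_single, one_mul, mul_comm, div_eq_mul_inv]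

theorem x_injective (n : ℕ) : Function.Injective (x n) :=
  (IsFractionRing.injective (MvPolynomial (Fin n) ℚ) (K n)).comp
    (MvPolynomial.X_injective (R := ℚ))

theorem prod_t_pow (n r : ℕ) (a : Fin r →₀ ℕ) :
    ∏ i, t n r i ^ a i =
      HahnSeries.single (toLex fun k => -(a (Fin.rev k) : ℤ)) 1 := by
  have h : ∀ s : Finset (Fin r), ∏ i ∈ s, t n r i ^ a i =
      HahnSeries.single (toLex (∑ i ∈ s, a i • Pi.single (Fin.rev i) (-1 : ℤ))) 1 := by
    intro s
    induction s using Finset.induction_on with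
    | empty => rfl
    | insert i s hi ih =>
      rw [Finset.prod_insert hi, Finset.sum_insert hi, ih, t, HahnSeries.single_pow,
        HahnSeries.single_mul_single, one_pow, mul_one]
      rfl
  rw [h]
  refine congrArg (fun e => HahnSeries.single (toLex e) 1) (funext fun k => ?_)
  rw [Finset.sum_apply, Finset.sum_eq_single (Fin.rev k)]
  · simp
  · intro i _ hi
    have : k ≠ Fin.rev i := fun h => hi (by rw [h, Fin.rev_rev])
    simp [this]
  · simp

/-- The coefficient extraction turns a polynomial in the `t_i` into its sum of values over all
tuples of roots, weighted by residues. -/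
theorem coeff_aeval_t_mul {n : ℕ} (hn : 1 ≤ n) (r : ℕ) (g : MvPolynomial (Fin r) ℚ) :
    (MvPolynomial.aeval (t n r) g *
      ∏ i : Fin r, ∏ j : Fin n, (1 - HahnSeries.C (x n j) * (t n r i)⁻¹)⁻¹).coeff
        (toLex fun _ => 1 - (n : ℤ)) =
      ∑ k : Fin r → Fin n, MvPolynomial.aeval (fun i => x n (k i)) g /
        ∏ i, ∏ j ∈ Finset.univ.erase (k i), (x n (k i) - x n j) := by
  rw [prod_inv_eq_laurentProd]
  induction g using MvPolynomial.induction_on' with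
  | add p q hp hq =>
    simp only [map_add, add_mul, add_div, HahnSeries.coeff_add, Finset.sum_add_distrib, hp, hq]
  | monomial a c =>
    have hc : algebraMap ℚ (H n r) c = HahnSeries.C (algebraMap ℚ (K n) c) :=
      congrArg (fun e : ℚ →+* H n r => e c)
        (Subsingleton.elim (algebraMap ℚ (H n r)) (HahnSeries.C.comp (algebraMap ℚ (K n))))
    simp only [MvPolynomial.aeval_monomial, Finsupp.prod_fintype, pow_zero, implies_true]
    rw [prod_t_pow, hc, mul_assoc, HahnSeries.C_apply, HahnSeries.coeff_single_mul, sub_zero,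
      HahnSeries.coeff_single_mul, one_mul, laurentProd_coeff]
    have h : ∀ i : Fin r, (∏ j, (1 - HahnSeries.single 1 (x n j))⁻¹).coeff
        (ofLex (toLex (fun _ : Fin r => 1 - (n : ℤ)) - toLex fun k => -(a (Fin.rev k) : ℤ))
          (Fin.rev i)) = ∑ k, x n k ^ a i / ∏ j ∈ Finset.univ.erase k, (x n k - x n j) := by
      intro i
      rw [← coeff_prod_inv_one_sub_single hn (x_injective n)]
      congr 1
      change (1 - n : ℤ) - -(a (Fin.rev (Fin.rev i)) : ℤ) = _
      rw [Fin.rev_rev, sub_neg_eq_add]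
    simp only [h, Finset.prod_univ_sum, Fintype.piFinset_univ, Finset.prod_div_distrib,
      Finset.mul_sum, mul_div_assoc]

/-- A permutation in `C(r,n)` is determined by its first `r` values. -/
theorem Cperm_injOn {n r : ℕ} (hrn : r ≤ n) :
    Set.InjOn (fun (w : Equiv.Perm (Fin n)) (i : Fin r) => w (Fin.castLE hrn i)) (Cperm r n) := by
  obtain ⟨m, rfl⟩ := Nat.exists_eq_add_of_le hrn
  intro w hw w' hw' h
  have hw : ∀ i j : Fin (r + m), r ≤ (i : ℕ) → i < j → w i < w j := by simpa [Cperm] using hw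
  have hw' : ∀ i j : Fin (r + m), r ≤ (i : ℕ) → i < j → w' i < w' j := by simpa [Cperm] using hw'
  have h0 : ∀ i : Fin r, w (Fin.castAdd m i) = w' (Fin.castAdd m i) := fun i => congrFun h i
  let S : Finset (Fin (r + m)) := (Finset.univ.image fun i : Fin r => w (Fin.castAdd m i))ᶜ
  have hS : S.card = m := by
    rw [Finset.card_compl, Finset.card_image_of_injective (f := fun i => w (Fin.castAdd m i)) _
      (w.injective.comp (Fin.castAdd_injective r m))]
    simp
  have key : ∀ u : Equiv.Perm (Fin (r + m)),
      (∀ i j : Fin (r + m), r ≤ (i : ℕ) → i < j → u i < u j) →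
      (∀ i, w (Fin.castAdd m i) = u (Fin.castAdd m i)) →
      (fun j => u (Fin.natAdd r j)) = S.orderEmbOfFin hS := by
    intro u hu hwu
    refine Finset.orderEmbOfFin_unique hS (fun j => ?_) fun i j hij => ?_
    · simp only [S, Finset.mem_compl, Finset.mem_image, Finset.mem_univ, true_and, not_exists, hwu]
      intro i hi
      have := congrArg Fin.val (u.injective hi)
      simp at this
      omega
    · exact hu _ _ (by simp) (by simpa using hij)
  have h1 := (key w hw fun _ => rfl).trans (key w' hw' h0).symm
  ext1 i
  induction i using Fin.addCases with
  | left i => exact h0 i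
  | right j => exact congrFun h1 j

theorem exists_mem_Cperm {n r : ℕ} (hrn : r ≤ n) {k : Fin r → Fin n} (hk : Function.Injective k) :
    ∃ w ∈ Cperm r n, (fun i : Fin r => w (Fin.castLE hrn i)) = k := by
  obtain ⟨m, rfl⟩ := Nat.exists_eq_add_of_le hrn
  have hS : (Finset.univ.image k)ᶜ.card = m := by
    rw [Finset.card_compl, Finset.card_image_of_injective _ hk]
    simp
  let e := (Finset.univ.image k)ᶜ.orderEmbOfFin hS
  have he : ∀ i j, k i ≠ e j := fun i j h => by
    have := Finset.orderEmbOfFin_mem _ hS j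
    rw [Finset.mem_compl] at this
    exact this (h ▸ Finset.mem_image_of_mem k (Finset.mem_univ i))
  have hinj : Function.Injective (Fin.append k e) := Fin.append_injective_iff.2 ⟨hk, e.injective, he⟩
  refine ⟨Equiv.ofBijective _ (Finite.injective_iff_bijective.1 hinj), ?_, ?_⟩
  · simp only [Cperm, Finset.mem_filter, Finset.mem_univ, true_and, Equiv.ofBijective_apply]
    intro i j hi hij
    induction i using Fin.addCases with
    | left i => simp at hi; omega
    | right i =>
      induction j using Fin.addCases with
      | left j => simp [Fin.lt_def] at hij; omega
      | right j => simpa using hij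
  · ext1 i
    exact Fin.append_left k e i

theorem prod_erase_sub {F : Type*} [CommRing F] {n r : ℕ} (hrn : r ≤ n) (v : Fin n → F)
    (w : Equiv.Perm (Fin n)) :
    ∏ i : Fin r, ∏ j ∈ Finset.univ.erase (w (Fin.castLE hrn i)),
        (v (w (Fin.castLE hrn i)) - v j) =
      (∏ i : Fin r, ∏ j ∈ Finset.Ioi i,
        (v (w (Fin.castLE hrn j)) - v (w (Fin.castLE hrn i)))) *
      ∏ i : Fin r, ∏ j ∈ Finset.Ioi (Fin.castLE hrn i),
        (v (w (Fin.castLE hrn i)) - v (w j)) := by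
  have hswap : ∏ i : Fin r, ∏ j ∈ Finset.Ioi i,
      (v (w (Fin.castLE hrn j)) - v (w (Fin.castLE hrn i))) =
      ∏ i : Fin r, ∏ j ∈ Finset.Iio i,
        (v (w (Fin.castLE hrn i)) - v (w (Fin.castLE hrn j))) :=
    Finset.prod_comm' (by simp)
  rw [hswap, ← Finset.prod_mul_distrib]
  refine Finset.prod_congr rfl fun i _ => ?_
  have h1 : Finset.univ.erase (w (Fin.castLE hrn i)) =
      (Finset.univ.erase (Fin.castLE hrn i)).map w.toEmbedding := by
    simp [Finset.map_erase]
  have h2 : Finset.univ.erase (Fin.castLE hrn i) =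
      ((Finset.Iio i).map (Fin.castLEEmb hrn)).disjUnion (Finset.Ioi (Fin.castLE hrn i)) (by
        rw [Finset.disjoint_left]
        simp only [Finset.mem_map, Finset.mem_Iio, Finset.mem_Ioi]
        rintro _ ⟨j, hj, rfl⟩ h
        exact lt_asymm h hj) := by
    ext j
    simp only [Finset.mem_erase, Finset.mem_univ, and_true, Finset.disjUnion_eq_union,
      Finset.mem_union, Finset.mem_map, Finset.mem_Iio, Finset.mem_Ioi]
    constructor
    · intro hj
      rcases lt_or_gt_of_ne hj with h | h
      · exact Or.inl ⟨⟨j, lt_trans h i.isLt⟩, h, rfl⟩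
      · exact Or.inr h
    · rintro (⟨k, hk, rfl⟩ | h)
      · simpa using hk.ne
      · exact h.ne'
  rw [h1, h2, Finset.prod_map, Finset.prod_disjUnion, Finset.prod_map]
  rfl

/-- **Type `A` Darondeau–Pragacz push-forward formula, additive (ordinary cohomology)
specialization.**  For `1 ≤ r ≤ n` and any polynomial `f` in `r` variables over `ℚ`,
`Σ_{w ∈ C(r,n)} w·( f(x_1,…,x_r) / ∏_{i=1}^r ∏_{j=i+1}^n (x_i − x_j) )`
equals the coefficient of `t_1^{n−1} ⋯ t_r^{n−1}` in
`f(t_1,…,t_r) · ∏_{1≤i<j≤r} (t_j − t_i) · ∏_{i=1}^r ∏_{j=1}^n ( Σ_{k≥0} x_j^k t_i^{−k} )`,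
where `Σ_{k≥0} x_j^k t_i^{−k} = (1 − x_j t_i^{−1})⁻¹`. -/
theorem darondeau_pragacz_additive
    (n r : ℕ) (hr : 1 ≤ r) (hrn : r ≤ n)
    (f : MvPolynomial (Fin r) ℚ) :
    (∑ w ∈ Cperm r n,
      (MvPolynomial.aeval (fun i : Fin r => x n (w (Fin.castLE hrn i))) f) /
      (∏ i : Fin r, ∏ j ∈ Finset.Ioi (Fin.castLE hrn i),
          (x n (w (Fin.castLE hrn i)) - x n (w j))))
    =
    ((MvPolynomial.aeval (fun i : Fin r => t n r i) f) *
      (∏ i : Fin r, ∏ j ∈ Finset.Ioi i, (t n r j - t n r i)) *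
      (∏ i : Fin r, ∏ j : Fin n,
          (1 - HahnSeries.C (x n j) * (t n r i)⁻¹)⁻¹)).coeff
        (toLex (fun _ : Fin r => (1 - (n : ℤ)))) := by
  let V : MvPolynomial (Fin r) ℚ :=
    ∏ i : Fin r, ∏ j ∈ Finset.Ioi i, (MvPolynomial.X j - MvPolynomial.X i)
  have hV : ∀ {A : Type} [CommRing A] [Algebra ℚ A] (y : Fin r → A),
      MvPolynomial.aeval y V = ∏ i : Fin r, ∏ j ∈ Finset.Ioi i, (y j - y i) := by
    intro A _ _ y
    simp [V, map_prod]
  have hV0 : ∀ {y : Fin r → K n}, Function.Injective y → MvPolynomial.aeval y V ≠ 0 := by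
    intro y hy
    rw [hV]
    exact Finset.prod_ne_zero_iff.2 fun i _ => Finset.prod_ne_zero_iff.2 fun j hj =>
      sub_ne_zero.2 (hy.ne (Finset.mem_Ioi.1 hj).ne')
  rw [← hV (t n r), ← map_mul, coeff_aeval_t_mul (hr.trans hrn)]
  refine Finset.sum_of_injOn _ (Cperm_injOn hrn) (fun _ _ => Finset.mem_univ _)
    (fun k _ hk => ?_) (fun w _ => ?_)
  · have hk' : ¬ Function.Injective k := fun h => hk (exists_mem_Cperm hrn h)
    obtain ⟨i, j, hij, hne⟩ := Function.not_injective_iff.1 hk'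
    wlog hlt : i < j generalizing i j
    · exact this j i hij.symm hne.symm (lt_of_le_of_ne (not_lt.1 hlt) hne.symm)
    rw [map_mul, hV, Finset.prod_eq_zero (Finset.mem_univ i)
      (Finset.prod_eq_zero (Finset.mem_Ioi.2 hlt) (by rw [hij, sub_self])), mul_zero, zero_div]
  · rw [map_mul, prod_erase_sub hrn (x n) w, ← hV fun i => x n (w (Fin.castLE hrn i)),
      mul_comm, mul_div_mul_left]
    exact hV0 ((x_injective n).comp (w.injective.comp (Fin.castLE_injective hrn)))
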